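/- Let E ⊂ R^d be compact with C^{1,1} boundary and x ∈ ∂E. Then the 0-fractional curvature H^0(x,E) := lim_{r→0+} ∫_{B_R(x) \ B_r(x)} (χ_{R^d\E}(y) − χ_E(y))/|x-y|^d dy − d ω_d log R is well defined and independent of R, for all R > diam(E). -/

import Mathlib

open MeasureTheory Metric Filter Set

/-- Volume of the unit ball in `ℝ^d` (the constant `ω_d`). -/
noncomputable def unitBallVol (d : ℕ) : ℝ :=
  (volume (Metric.ball (0 : EuclideanSpace ℝ (Fin d)) 1)).toReal

/-- `χ_{ℝ^d ∖ E}(y) - χ_E(y)`. -/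
noncomputable def chiDiff {d : ℕ} (E : Set (EuclideanSpace ℝ (Fin d)))
    (y : EuclideanSpace ℝ (Fin d)) : ℝ :=
  Set.indicator Eᶜ (fun _ => (1:ℝ)) y - Set.indicator E (fun _ => (1:ℝ)) y

/-- The unit vector `e_d` (last coordinate direction) in `ℝ^d`. -/
noncomputable def ed (d : ℕ) : EuclideanSpace ℝ (Fin d) :=
  if h : 0 < d then EuclideanSpace.single (⟨d - 1, by omega⟩ : Fin d) 1 else 0

/-- `H` is the value of the `s`-fractional curvature of `E` at `x`, defined as the
principal value `lim_{r→0⁺} ∫_{ℝ^d ∖ B_r(x)} (χ_{Eᶜ}(y) - χ_E(y))/|x-y|^{d+s} dy`. -/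
def HasFracCurv {d : ℕ} (s : ℝ) (E : Set (EuclideanSpace ℝ (Fin d)))
    (x : EuclideanSpace ℝ (Fin d)) (H : ℝ) : Prop :=
  Tendsto (fun r : ℝ => ∫ y in (Metric.ball x r)ᶜ, chiDiff E y / ‖y - x‖ ^ ((d:ℝ) + s))
    (nhdsWithin 0 (Set.Ioi 0)) (nhds H)

/-- Uniform two-sided (interior and exterior) tangent ball condition: the standard
geometric characterization of a set with compact boundary of class `C^{1,1}`. -/
def TwoSidedBallCond {d : ℕ} (E : Set (EuclideanSpace ℝ (Fin d))) : Prop :=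
  ∃ δ > 0, ∀ x ∈ frontier E, ∃ ν : EuclideanSpace ℝ (Fin d), ‖ν‖ = 1 ∧
    Metric.ball (x - δ • ν) δ ⊆ E ∧ Metric.ball (x + δ • ν) δ ⊆ Eᶜ

/-- The `0`-fractional curvature `H^0(x,E)`, defined with the cutoff radius
`R = diam E + 1 > diam E` (the value is independent of the choice of `R > diam E`). -/
noncomputable def H0 {d : ℕ} (E : Set (EuclideanSpace ℝ (Fin d)))
    (x : EuclideanSpace ℝ (Fin d)) : ℝ :=
  limUnder (nhdsWithin (0:ℝ) (Set.Ioi 0))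
    (fun r => ∫ y in Metric.ball x (Metric.diam E + 1) \ Metric.ball x r,
      chiDiff E y / ‖y - x‖ ^ (d:ℝ))
  - d * unitBallVol d * Real.log (Metric.diam E + 1)

/-- The `s`-Riesz curvature `K^s(x,E) = -2 ∫_E |x-y|^{-(d+s)} dy` of a compact set. -/
noncomputable def Ks {d : ℕ} (s : ℝ) (E : Set (EuclideanSpace ℝ (Fin d)))
    (x : EuclideanSpace ℝ (Fin d)) : ℝ :=
  -2 * ∫ y in E, 1 / ‖x - y‖ ^ ((d:ℝ) + s)

/-- Outer Minkowski curvature `κ_r^{ou}(x,E)` relative to a normal (vector) field `ν`. -/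
noncomputable def kappaOut {d : ℕ} (E : Set (EuclideanSpace ℝ (Fin d)))
    (ν : EuclideanSpace ℝ (Fin d) → EuclideanSpace ℝ (Fin d)) (r : ℝ)
    (x : EuclideanSpace ℝ (Fin d)) : ℝ :=
  if Metric.infDist (x + r • ν x) E = r then
    (1 / (2 * r)) * LinearMap.det
      ((ContinuousLinearMap.id ℝ (EuclideanSpace ℝ (Fin d)) + r • fderiv ℝ ν x).toLinearMap)
  else 0

/-- Inner Minkowski curvature `κ_r^{in}(x,E)` relative to a normal (vector) field `ν`. -/
noncomputable def kappaIn {d : ℕ} (E : Set (EuclideanSpace ℝ (Fin d)))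
    (ν : EuclideanSpace ℝ (Fin d) → EuclideanSpace ℝ (Fin d)) (r : ℝ)
    (x : EuclideanSpace ℝ (Fin d)) : ℝ :=
  if Metric.infDist (x - r • ν x) Eᶜ = r then
    -(1 / (2 * r)) * LinearMap.det
      ((ContinuousLinearMap.id ℝ (EuclideanSpace ℝ (Fin d)) - r • fderiv ℝ ν x).toLinearMap)
  else 0

/-- Regularized Minkowski curvature `κ_r^f(x,E) = ∫_0^1 (-s f'(s)) κ_{rs}(x,E) ds`. -/
noncomputable def kappaF {d : ℕ} (f : ℝ → ℝ) (E : Set (EuclideanSpace ℝ (Fin d)))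
    (ν : EuclideanSpace ℝ (Fin d) → EuclideanSpace ℝ (Fin d)) (r : ℝ)
    (x : EuclideanSpace ℝ (Fin d)) : ℝ :=
  ∫ t in Set.Ioc (0:ℝ) 1, (-t * deriv f t) * (kappaOut E ν (r*t) x + kappaIn E ν (r*t) x)

open scoped RealInnerProductSpace ENNReal

section Slab

variable {d : ℕ}

lemma volume_slab_inter_closedBall_le (hd : 0 < d) {ν : EuclideanSpace ℝ (Fin d)}
    (hν : ‖ν‖ = 1) (h ρ : ℝ) :
    volume {z : EuclideanSpace ℝ (Fin d) | |⟪ν, z⟫| ≤ h ∧ ‖z‖ ≤ ρ} ≤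
      ENNReal.ofReal (2 * h) * ENNReal.ofReal (2 * ρ) ^ (d - 1) := by
  let i₀ : Fin d := ⟨0, hd⟩
  obtain ⟨b, hb⟩ := Orthonormal.exists_orthonormalBasis_extension_of_card_eq (𝕜 := ℝ)
    (E := EuclideanSpace ℝ (Fin d)) (ι := Fin d) (by simp) (v := fun _ => ν) (s := {i₀})
    (by
      refine ⟨fun i => by simpa using hν, fun i j hij => ?_⟩
      exact absurd (Subsingleton.elim i j) hij)
  have hmp := (PiLp.volume_preserving_ofLp (Fin d)).comp b.measurePreserving_repr
  let box : Set (Fin d → ℝ) :=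
    Set.univ.pi fun i => if i = i₀ then Set.Icc (-h) h else Set.Icc (-ρ) ρ
  have hbox : MeasurableSet box :=
    MeasurableSet.univ_pi fun i => by split_ifs <;> exact measurableSet_Icc
  calc volume {z : EuclideanSpace ℝ (Fin d) | |⟪ν, z⟫| ≤ h ∧ ‖z‖ ≤ ρ}
      ≤ volume ((WithLp.ofLp ∘ b.repr) ⁻¹' box) := by
        refine measure_mono fun z hz i _ => ?_
        have hz' : |b.repr z i| ≤ ρ := by
          have := PiLp.norm_apply_le (b.repr z) i
          rw [LinearIsometryEquiv.norm_map] at this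
          exact this.trans hz.2
        by_cases hi : i = i₀
        · subst hi
          have := hz.1
          rw [← hb i₀ rfl, ← b.repr_apply_apply] at this
          simpa using abs_le.1 this
        · simpa [hi] using abs_le.1 hz'
    _ = volume box := hmp.measure_preimage hbox.nullMeasurableSet
    _ = ENNReal.ofReal (2 * h) * ENNReal.ofReal (2 * ρ) ^ (d - 1) := by
        rw [volume_pi_pi, Fintype.prod_eq_mul_prod_compl i₀, if_pos rfl,
          Finset.prod_congr rfl (g := fun _ => ENNReal.ofReal (2 * ρ))]
        · simp [Finset.card_compl, two_mul]
        · intro i hi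
          simp only [Finset.mem_compl, Finset.mem_singleton] at hi
          simp [hi, two_mul]

/-- The points which lie in neither of the two open balls of radius `δ` tangent at the origin to
the hyperplane with normal `ν`. -/
def tangentBallsCompl (ν : EuclideanSpace ℝ (Fin d)) (δ : ℝ) : Set (EuclideanSpace ℝ (Fin d)) :=
  {z | 2 * δ * |⟪ν, z⟫| ≤ ‖z‖ ^ 2}

lemma measurableSet_tangentBallsCompl (ν : EuclideanSpace ℝ (Fin d)) (δ : ℝ) :
    MeasurableSet (tangentBallsCompl ν δ) :=
  (isClosed_le (by fun_prop) (by fun_prop)).measurableSet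

lemma volume_tangentBallsCompl_inter_closedBall_le (hd : 0 < d) {ν : EuclideanSpace ℝ (Fin d)}
    (hν : ‖ν‖ = 1) {δ : ℝ} (hδ : 0 < δ) {ρ : ℝ} (hρ : 0 ≤ ρ) :
    volume (tangentBallsCompl ν δ ∩ closedBall 0 ρ) ≤
      ENNReal.ofReal (2 ^ (d - 1) / δ * ρ ^ (d + 1)) := by
  have hsub : tangentBallsCompl ν δ ∩ closedBall 0 ρ ⊆
      {z | |⟪ν, z⟫| ≤ ρ ^ 2 / (2 * δ) ∧ ‖z‖ ≤ ρ} := by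
    rintro z ⟨hz, hzρ⟩
    rw [mem_closedBall_zero_iff] at hzρ
    refine ⟨?_, hzρ⟩
    rw [le_div_iff₀ (by positivity), mul_comm]
    exact le_trans hz (by gcongr)
  refine (measure_mono hsub).trans
    ((volume_slab_inter_closedBall_le hd hν _ _).trans (le_of_eq ?_))
  rw [← ENNReal.ofReal_pow (by positivity), ← ENNReal.ofReal_mul (by positivity)]
  obtain ⟨n, rfl⟩ := Nat.exists_eq_add_of_lt hd
  congr 1
  simp only [zero_add, Nat.add_sub_cancel]
  field_simp
  ring

lemma integrableOn_tangentBallsCompl_inter_ball (hd : 0 < d) {ν : EuclideanSpace ℝ (Fin d)}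
    (hν : ‖ν‖ = 1) {δ : ℝ} (hδ : 0 < δ) (R : ℝ) :
    IntegrableOn (fun z : EuclideanSpace ℝ (Fin d) => (‖z‖ ^ d)⁻¹)
      (tangentBallsCompl ν δ ∩ ball 0 R) := by
  have hd' : (0 : ℝ) < d := by exact_mod_cast hd
  set S := tangentBallsCompl ν δ ∩ ball 0 R with hS
  have hSm : MeasurableSet S := (measurableSet_tangentBallsCompl ν δ).inter measurableSet_ball
  have hm : Measurable fun z : EuclideanSpace ℝ (Fin d) => (‖z‖ ^ d)⁻¹ := by fun_prop
  have hnn : ∀ z : EuclideanSpace ℝ (Fin d), 0 ≤ (‖z‖ ^ d)⁻¹ := fun z => by positivity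
  set C : ℝ := 2 ^ (d - 1) / δ
  have hC : 0 ≤ C := by positivity
  have hlarge : ∀ t : ℝ, 0 < t → volume.restrict S {z | t < (‖z‖ ^ d)⁻¹} ≤
      ENNReal.ofReal (C * t ^ (-(1 + 1 / (d : ℝ)))) := by
    intro t ht
    have hsub : {z | t < (‖z‖ ^ d)⁻¹} ∩ S ⊆
        tangentBallsCompl ν δ ∩ closedBall 0 (t ^ (-(1 / (d : ℝ)))) := by
      rintro z ⟨hz, hzS, -⟩
      refine ⟨hzS, ?_⟩
      rw [mem_closedBall_zero_iff]
      have hzt : ‖z‖ ^ d ≤ t⁻¹ := by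
        have hpos : 0 < ‖z‖ ^ d := inv_pos.1 (ht.trans hz)
        exact (le_inv_comm₀ ht hpos).1 (le_of_lt hz)
      calc ‖z‖ = (‖z‖ ^ d) ^ (1 / (d : ℝ)) := by
            rw [← Real.rpow_natCast, ← Real.rpow_mul (norm_nonneg z),
              mul_one_div_cancel hd'.ne', Real.rpow_one]
        _ ≤ (t⁻¹) ^ (1 / (d : ℝ)) := by gcongr
        _ = t ^ (-(1 / (d : ℝ))) := by rw [Real.inv_rpow ht.le, Real.rpow_neg ht.le]
    rw [Measure.restrict_apply (measurableSet_lt measurable_const hm)]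
    refine (measure_mono hsub).trans ((volume_tangentBallsCompl_inter_closedBall_le hd hν hδ
      (by positivity)).trans (le_of_eq ?_))
    rw [← Real.rpow_natCast (t ^ _), ← Real.rpow_mul ht.le]
    congr 3
    push_cast
    field_simp
  refine ⟨hm.aestronglyMeasurable, ?_⟩
  rw [hasFiniteIntegral_iff_ofReal (ae_of_all _ hnn),
    lintegral_eq_lintegral_meas_lt _ (ae_of_all _ hnn) hm.aemeasurable,
    ← Set.Ioc_union_Ioi_eq_Ioi zero_le_one,
    lintegral_union measurableSet_Ioi (Set.Ioc_disjoint_Ioi le_rfl)]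
  refine ENNReal.add_lt_top.2 ⟨?_, ?_⟩
  · calc ∫⁻ t in Set.Ioc (0 : ℝ) 1, volume.restrict S {z | t < (‖z‖ ^ d)⁻¹}
        ≤ ∫⁻ _ in Set.Ioc (0 : ℝ) 1, volume S :=
          lintegral_mono fun t => (measure_mono (Set.subset_univ _)).trans (by simp)
      _ < ∞ := by
          have : volume S < ∞ := (measure_mono Set.inter_subset_right).trans_lt measure_ball_lt_top
          simpa using this
  · have hint : IntegrableOn (fun t : ℝ => C * t ^ (-(1 + 1 / (d : ℝ)))) (Set.Ioi 1) :=
      (integrableOn_Ioi_rpow_of_lt (by have := one_div_pos.2 hd'; linarith) one_pos).const_mul C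
    have := (hasFiniteIntegral_iff_ofReal ((ae_restrict_iff' measurableSet_Ioi).2
      (ae_of_all _ fun t (ht : 1 < t) => by positivity))).1 hint.2
    exact (setLIntegral_mono' measurableSet_Ioi fun t (ht : 1 < t) =>
      hlarge t (by linarith)).trans_lt this

end Slab

section PrincipalValue

variable {d : ℕ}

lemma setIntegral_annulus_inv_norm_pow (hd : 0 < d) (x : EuclideanSpace ℝ (Fin d)) {R R' : ℝ}
    (hR : 0 < R) (hRR' : R ≤ R') :
    ∫ y in ball x R' \ ball x R, (‖y - x‖ ^ d)⁻¹ =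
      d * unitBallVol d * (Real.log R' - Real.log R) := by
  have : NeZero d := ⟨hd.ne'⟩
  set f : ℝ → ℝ := (Set.Ico R R').indicator fun t => (t ^ d)⁻¹ with hf
  have hind : (ball x R' \ ball x R).indicator (fun y => (‖y - x‖ ^ d)⁻¹) =
      fun y => f ‖y - x‖ := by
    classical
    funext y
    simp only [hf, Set.indicator_apply, Set.mem_sdiff, mem_ball, dist_eq_norm, not_lt, Set.mem_Ico,
      and_comm]
  have hradial : ∫ t in Set.Ioi (0 : ℝ), t ^ (d - 1) • f t = Real.log R' - Real.log R := by
    have hcongr : ∀ t ∈ Set.Ioi (0 : ℝ),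
        t ^ (d - 1) • f t = (Set.Ico R R').indicator (fun t => t⁻¹) t := by
      intro t (ht : 0 < t)
      simp only [hf, Set.indicator_apply, smul_eq_mul]
      split_ifs
      · obtain ⟨n, rfl⟩ := Nat.exists_eq_add_of_lt hd
        simp only [zero_add, Nat.add_sub_cancel]
        field_simp
        ring
      · simp
    rw [setIntegral_congr_fun measurableSet_Ioi hcongr, setIntegral_indicator measurableSet_Ico,
      Set.inter_eq_right.2 fun t (ht : t ∈ Set.Ico R R') => Set.mem_Ioi.2 (hR.trans_le ht.1),
      integral_Ico_eq_integral_Ioc,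
      ← intervalIntegral.integral_of_le hRR', integral_inv_of_pos hR (hR.trans_le hRR'),
      Real.log_div (hR.trans_le hRR').ne' hR.ne']
  rw [← integral_indicator (measurableSet_ball.diff measurableSet_ball), hind,
    integral_sub_right_eq_self (fun z => f ‖z‖) x, integral_fun_norm_addHaar, finrank_euclideanSpace,
    Fintype.card_fin, hradial]
  simp [unitBallVol, Measure.real, mul_assoc]

lemma abs_chiDiff (E : Set (EuclideanSpace ℝ (Fin d))) (y : EuclideanSpace ℝ (Fin d)) :
    |chiDiff E y| = 1 := by
  by_cases hy : y ∈ E <;> simp [chiDiff, hy]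

lemma chiDiff_of_mem {E : Set (EuclideanSpace ℝ (Fin d))} {y : EuclideanSpace ℝ (Fin d)}
    (hy : y ∈ E) : chiDiff E y = -1 := by
  simp [chiDiff, hy]

lemma chiDiff_of_notMem {E : Set (EuclideanSpace ℝ (Fin d))} {y : EuclideanSpace ℝ (Fin d)}
    (hy : y ∉ E) : chiDiff E y = 1 := by
  simp [chiDiff, hy]

lemma measurable_chiDiff {E : Set (EuclideanSpace ℝ (Fin d))} (hE : MeasurableSet E) :
    Measurable (chiDiff E) :=
  (measurable_const.indicator hE.compl).sub (measurable_const.indicator hE)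

lemma integrableOn_annulus_chiDiff_div {E : Set (EuclideanSpace ℝ (Fin d))}
    (hE : MeasurableSet E) (x : EuclideanSpace ℝ (Fin d)) (R : ℝ) {r : ℝ} (hr : 0 < r) :
    IntegrableOn (fun y => chiDiff E y / ‖y - x‖ ^ d) (ball x R \ ball x r) := by
  have hm : Measurable fun y => chiDiff E y / ‖y - x‖ ^ d :=
    (measurable_chiDiff hE).div (by fun_prop)
  have hfin : volume (ball x R \ ball x r) < ∞ :=
    (measure_mono sdiff_subset).trans_lt measure_ball_lt_top
  refine Measure.integrableOn_of_bounded (M := (r ^ d)⁻¹) hfin.ne hm.aestronglyMeasurable ?_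
  refine (ae_restrict_iff' (measurableSet_ball.diff measurableSet_ball)).2 (ae_of_all _ ?_)
  rintro y ⟨-, hy⟩
  have hy' : r ≤ ‖y - x‖ := by simpa [dist_eq_norm] using hy
  rw [norm_div, Real.norm_eq_abs, abs_chiDiff, one_div, norm_pow, norm_norm]
  gcongr

/-- Enlarging the cutoff radius beyond a ball containing `E` only adds a logarithm. -/
lemma setIntegral_chiDiff_div_sub_log (hd : 0 < d) {E : Set (EuclideanSpace ℝ (Fin d))}
    (hE : MeasurableSet E) {x : EuclideanSpace ℝ (Fin d)} {R R' r : ℝ}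
    (hER : E ⊆ ball x R) (hr : 0 < r) (hrR : r ≤ R) (hRR' : R ≤ R') :
    (∫ y in ball x R' \ ball x r, chiDiff E y / ‖y - x‖ ^ d) -
        d * unitBallVol d * Real.log R' =
      (∫ y in ball x R \ ball x r, chiDiff E y / ‖y - x‖ ^ d) -
        d * unitBallVol d * Real.log R := by
  have hunion : ball x R' \ ball x r = (ball x R \ ball x r) ∪ (ball x R' \ ball x R) := by
    have h₁ : ball x r ⊆ ball x R := ball_subset_ball hrR
    have h₂ : ball x R ⊆ ball x R' := ball_subset_ball hRR'
    ext y
    have := @h₁ y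
    have := @h₂ y
    simp only [Set.mem_sdiff, mem_union]
    tauto
  have hdisj : Disjoint (ball x R \ ball x r) (ball x R' \ ball x R) :=
    Set.disjoint_left.2 fun y hy hy' => hy'.2 hy.1
  have hout : ∫ y in ball x R' \ ball x R, chiDiff E y / ‖y - x‖ ^ d =
      d * unitBallVol d * (Real.log R' - Real.log R) := by
    rw [← setIntegral_annulus_inv_norm_pow hd x (hr.trans_le hrR) hRR']
    refine setIntegral_congr_fun (measurableSet_ball.diff measurableSet_ball) fun y hy => ?_
    simp only [chiDiff_of_notMem fun hyE => hy.2 (hER hyE), one_div]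
  rw [hunion, setIntegral_union hdisj (measurableSet_ball.diff measurableSet_ball)
    (integrableOn_annulus_chiDiff_div hE x R hr)
    (integrableOn_annulus_chiDiff_div hE x R' (hr.trans_le hrR)), hout]
  ring

/-- The even part, with respect to the reflection through `x`, of the integrand
`chiDiff E y / ‖y - x‖ ^ d`. -/
noncomputable def symmIntegrand (E : Set (EuclideanSpace ℝ (Fin d)))
    (x y : EuclideanSpace ℝ (Fin d)) : ℝ :=
  (chiDiff E y / ‖y - x‖ ^ d + chiDiff E (x + x - y) / ‖x + x - y - x‖ ^ d) / 2

lemma symmIntegrand_eq (E : Set (EuclideanSpace ℝ (Fin d))) (x y : EuclideanSpace ℝ (Fin d)) :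
    symmIntegrand E x y = (chiDiff E y + chiDiff E (x + x - y)) / 2 * (‖y - x‖ ^ d)⁻¹ := by
  have : ‖x + x - y - x‖ = ‖y - x‖ := by rw [← norm_neg]; congr 1; abel
  rw [symmIntegrand, this]
  ring

lemma measurable_symmIntegrand {E : Set (EuclideanSpace ℝ (Fin d))} (hE : MeasurableSet E)
    (x : EuclideanSpace ℝ (Fin d)) : Measurable (symmIntegrand E x) := by
  have := measurable_chiDiff hE
  unfold symmIntegrand
  fun_prop

lemma setIntegral_annulus_symmIntegrand {E : Set (EuclideanSpace ℝ (Fin d))}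
    (hE : MeasurableSet E) (x : EuclideanSpace ℝ (Fin d)) (R : ℝ) {r : ℝ} (hr : 0 < r) :
    ∫ y in ball x R \ ball x r, symmIntegrand E x y =
      ∫ y in ball x R \ ball x r, chiDiff E y / ‖y - x‖ ^ d := by
  set A := ball x R \ ball x r
  set f : EuclideanSpace ℝ (Fin d) → ℝ := fun y => chiDiff E y / ‖y - x‖ ^ d
  have hA : MeasurableSet A := measurableSet_ball.diff measurableSet_ball
  have hf : IntegrableOn f A := integrableOn_annulus_chiDiff_div hE x R hr
  have hmp := Measure.measurePreserving_sub_left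
    (volume : Measure (EuclideanSpace ℝ (Fin d))) (x + x)
  have hemb : MeasurableEmbedding fun y : EuclideanSpace ℝ (Fin d) => x + x - y :=
    (MeasurableEquiv.subLeft (x + x)).measurableEmbedding
  have hpre : (fun y => x + x - y) ⁻¹' A = A := by
    ext y
    have : dist (x + x - y) x = dist y x := by
      rw [dist_eq_norm, dist_eq_norm, ← norm_neg]; congr 1; abel
    simp only [A, mem_preimage, Set.mem_sdiff, mem_ball, this]
  have hfrefl : IntegrableOn (fun y => f (x + x - y)) A := by
    have := (hmp.integrableOn_comp_preimage hemb (f := f) (s := A)).2 hf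
    rwa [hpre] at this
  have hint : ∫ y in A, f (x + x - y) = ∫ y in A, f y := by
    have := hmp.setIntegral_preimage_emb hemb f A
    rwa [hpre] at this
  change ∫ y in A, (f y + f (x + x - y)) / 2 = ∫ y in A, f y
  rw [integral_div, integral_add hf hfrefl, hint]
  ring

lemma norm_symmIntegrand_le {E : Set (EuclideanSpace ℝ (Fin d))}
    {x ν : EuclideanSpace ℝ (Fin d)} {δ : ℝ} (hν : ‖ν‖ = 1)
    (hin : ball (x - δ • ν) δ ⊆ E) (hout : ball (x + δ • ν) δ ⊆ Eᶜ) (hδ : 0 < δ)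
    (y : EuclideanSpace ℝ (Fin d)) :
    ‖symmIntegrand E x y‖ ≤
      (tangentBallsCompl ν δ).indicator (fun z => (‖z‖ ^ d)⁻¹) (y - x) := by
  have hsq : ∀ z : EuclideanSpace ℝ (Fin d), ‖z‖ ^ 2 < 2 * δ * ⟪ν, z⟫ → ‖z - δ • ν‖ < δ := by
    intro z hz
    refine lt_of_pow_lt_pow_left₀ 2 hδ.le ?_
    rw [norm_sub_sq_real, inner_smul_right, real_inner_comm, norm_smul, hν, mul_one,
      Real.norm_eq_abs, sq_abs]
    linarith
  rw [symmIntegrand_eq]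
  by_cases hy : y - x ∈ tangentBallsCompl ν δ
  · rw [Set.indicator_of_mem hy, norm_mul, Real.norm_eq_abs, norm_inv, norm_pow, norm_norm]
    refine mul_le_of_le_one_left (by positivity) ?_
    rw [abs_div, abs_two, div_le_one two_pos]
    refine (abs_add_le _ _).trans ?_
    rw [abs_chiDiff, abs_chiDiff]
    norm_num
  · rw [Set.indicator_of_notMem hy]
    have hy' : ‖y - x‖ ^ 2 < 2 * δ * |⟪ν, y - x⟫| := not_le.1 hy
    rcases le_total 0 ⟪ν, y - x⟫ with h | h
    · rw [abs_of_nonneg h] at hy'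
      have hlt := hsq _ hy'
      have h₁ : y ∉ E := hout <| by
        rw [mem_ball, dist_eq_norm]; convert hlt using 2; congr 1; module
      have h₂ : x + x - y ∈ E := hin <| by
        rw [mem_ball, dist_eq_norm, ← norm_neg]; convert hlt using 2; congr 1; module
      simp [chiDiff_of_mem h₂, chiDiff_of_notMem h₁]
    · have hneg : ⟪ν, x - y⟫ = -⟪ν, y - x⟫ := by rw [← inner_neg_right, neg_sub]
      rw [abs_of_nonpos h, ← hneg, norm_sub_rev] at hy'
      have hlt := hsq _ hy'
      have h₁ : y ∈ E := hin <| by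
        rw [mem_ball, dist_eq_norm, ← norm_neg]; convert hlt using 2; congr 1; module
      have h₂ : x + x - y ∉ E := hout <| by
        rw [mem_ball, dist_eq_norm]; convert hlt using 2; congr 1; module
      simp [chiDiff_of_mem h₁, chiDiff_of_notMem h₂]

lemma integrableOn_ball_symmIntegrand (hd : 0 < d) {E : Set (EuclideanSpace ℝ (Fin d))}
    (hE : MeasurableSet E) (hreg : TwoSidedBallCond E) {x : EuclideanSpace ℝ (Fin d)}
    (hx : x ∈ frontier E) (R : ℝ) : IntegrableOn (symmIntegrand E x) (ball x R) := by
  obtain ⟨δ, hδ, h⟩ := hreg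
  obtain ⟨ν, hν, hin, hout⟩ := h x hx
  have hS := measurableSet_tangentBallsCompl ν δ
  have hbound : Integrable ((tangentBallsCompl ν δ ∩ ball 0 R).indicator
      fun z => (‖z‖ ^ d)⁻¹) :=
    (integrableOn_tangentBallsCompl_inter_ball hd hν hδ R).integrable_indicator
      (hS.inter measurableSet_ball)
  refine Integrable.mono' (hbound.comp_sub_right x).integrableOn
    (measurable_symmIntegrand hE x).aestronglyMeasurable ?_
  refine (ae_restrict_iff' measurableSet_ball).2 (ae_of_all _ fun y hy => ?_)
  refine (norm_symmIntegrand_le hν hin hout hδ y).trans (le_of_eq ?_)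
  have hy' : y - x ∈ ball 0 R := by simpa [dist_eq_norm] using hy
  rw [Set.inter_comm, ← Set.indicator_indicator, Set.indicator_of_mem hy']

lemma tendsto_setIntegral_annulus (hd : 0 < d) {f : EuclideanSpace ℝ (Fin d) → ℝ}
    {x : EuclideanSpace ℝ (Fin d)} {R : ℝ} (hf : IntegrableOn f (ball x R)) :
    Tendsto (fun r => ∫ y in ball x R \ ball x r, f y) (nhdsWithin 0 (Set.Ioi 0))
      (nhds (∫ y in ball x R, f y)) := by
  have : NeZero d := ⟨hd.ne'⟩
  simp_rw [Set.sdiff_eq, Set.inter_comm (ball x R)]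
  simp_rw [fun r : ℝ => (Measure.restrict_restrict
    (μ := (volume : Measure (EuclideanSpace ℝ (Fin d))))
    (measurableSet_ball (x := x) (ε := r)).compl (t := ball x R)).symm,
    fun r : ℝ => (integral_indicator (μ := volume.restrict (ball x R)) (f := f)
      (measurableSet_ball (x := x) (ε := r)).compl).symm]
  refine tendsto_integral_filter_of_dominated_convergence (fun y => ‖f y‖)
    (Eventually.of_forall fun r =>
      hf.aestronglyMeasurable.indicator measurableSet_ball.compl)
    (Eventually.of_forall fun r => ae_of_all _ fun y => norm_indicator_le_norm_self _ _)
    hf.norm ?_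
  have hne : ∀ᵐ y ∂(volume.restrict (ball x R)), y ≠ x :=
    ae_restrict_of_ae (measure_eq_zero_iff_ae_notMem.1 (measure_singleton x))
  filter_upwards [hne] with y hy
  refine tendsto_const_nhds.congr' ?_
  filter_upwards [nhdsWithin_le_nhds (Iio_mem_nhds (dist_pos.2 hy))] with r hr
  rw [Set.indicator_of_mem]
  simpa using le_of_lt hr

end PrincipalValue

/-- the `0`-fractional curvature is well defined: for compact `E` of class
`C^{1,1}` and `x ∈ ∂E`, there is `H ∈ ℝ` such that for every `R > diam E` the principal
value `lim_{r→0⁺} ∫_{B_R(x)∖B_r(x)} (χ_{Eᶜ}-χ_E)/|x-y|^d dy` exists and equals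
`H + d ω_d log R` (i.e. the value `H` is independent of `R`). -/
theorem stmt_4 (d : ℕ) (hd : 0 < d) (E : Set (EuclideanSpace ℝ (Fin d)))
    (hEc : IsCompact E) (hreg : TwoSidedBallCond E)
    (x : EuclideanSpace ℝ (Fin d)) (hx : x ∈ frontier E) :
    ∃ H : ℝ, ∀ R : ℝ, Metric.diam E < R →
      Tendsto (fun r : ℝ =>
          ∫ y in Metric.ball x R \ Metric.ball x r, chiDiff E y / ‖y - x‖ ^ (d:ℝ))
        (nhdsWithin 0 (Set.Ioi 0))
        (nhds (H + d * unitBallVol d * Real.log R)) := by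
  have hE := hEc.isClosed.measurableSet
  have hball : ∀ R : ℝ, diam E < R → E ⊆ ball x R := fun R hR y hy =>
    (dist_le_diam_of_mem hEc.isBounded hy (hEc.isClosed.frontier_subset hx)).trans_lt hR
  have hpos : ∀ R : ℝ, diam E < R → 0 < R := fun R hR => diam_nonneg.trans_lt hR
  obtain ⟨R₀, hR₀⟩ := exists_gt (diam E)
  have hlim := tendsto_setIntegral_annulus hd (integrableOn_ball_symmIntegrand hd hE hreg hx R₀)
  refine ⟨(∫ y in ball x R₀, symmIntegrand E x y) - d * unitBallVol d * Real.log R₀,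
    fun R hR => ?_⟩
  simp_rw [Real.rpow_natCast]
  refine ((hlim.sub_const _).add_const _).congr' ?_
  filter_upwards [self_mem_nhdsWithin,
    nhdsWithin_le_nhds (Iio_mem_nhds (hpos R hR)),
    nhdsWithin_le_nhds (Iio_mem_nhds (hpos R₀ hR₀))] with r (hr : 0 < r) hrR hrR₀
  rw [setIntegral_annulus_symmIntegrand hE x R₀ hr, ← eq_sub_iff_add_eq]
  rcases le_total R₀ R with h | h
  · exact (setIntegral_chiDiff_div_sub_log hd hE (hball R₀ hR₀) hr (le_of_lt hrR₀) h).symm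
  · exact setIntegral_chiDiff_div_sub_log hd hE (hball R hR) hr (le_of_lt hrR) h
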